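/- Let G be the context-free grammar with nonterminals {S, A, B, C}, terminals {t, p}, start symbol S, and productions S → pS, S → p, S → A, A → AB, A → C, B → C, C → t. Let A'' be the monadic transducer over input alphabet {S, A, B, C, t, p} and output alphabet {a, b, c, ⊥} defined by A''(w) = λ if w = S; A''(w) = a if w ∈ AB*; A''(w) = b if w ∈ C⁺B*; A''(w) = c if w ∈ t⁺C*; and A''(w) = ⊥ otherwise. Then the grammar/observer system Ω = (G, A'') satisfies L_{⊥,f}(Ω) = { aⁿbⁿcⁿ : n > 0 }, a non-context-free (context-sensitive) language. -/

import Mathlib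

/-!  Common definitions for "computing by observing" G/O systems.

A monadic transducer with input alphabet `V` and output alphabet `Γ` is modelled by its
input/output function `A : List V → Option Γ` (`none` standing for the empty output `λ`),
together with the property `ObserverRegular A` saying that every fiber of `A` is a regular
language (equivalently, `A` is computed by a complete deterministic finite automaton whose
states are labelled by `Γ ∪ {λ}`).

For a G/O system the output alphabet is `Σ ∪ {⊥}`, modelled as `Option Sig` with
`none` standing for `⊥`; hence observers of G/O systems have type
`List (Symbol T G.NT) → Option (Option Sig)`. -/

/-- Every fiber of the transducer map is a regular language (and the fibers obviously
partition `V*`): this characterizes maps computed by complete deterministic finite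
automata with output-labelled states, i.e. monadic transducers. -/
def ObserverRegular {V Γ : Type*} (A : List V → Option Γ) : Prop :=
  ∀ o : Option Γ, Language.IsRegular ({ w : List V | A w = o } : Language V)

/-- The number of occurrences of nonterminal symbols in a sentential form. -/
def nonterminalCount {T NT : Type*} (w : List (Symbol T NT)) : ℕ :=
  (w.filter fun s => match s with | Symbol.nonterminal _ => true | _ => false).length

/-- The language `L_f(Ω)` (free mode) of the G/O system `Ω = (G, A)`, a language over the
alphabet `Σ ∪ {⊥}` (= `Option Sig`, `none` being `⊥`): all concatenations
`A(w₀)A(w₁)⋯A(wₙ)` of observer outputs along terminating derivations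
`S = w₀ ⇒ w₁ ⇒ ⋯ ⇒ wₙ` of `G` with `wₙ` consisting of terminals only. -/
def goLang {T : Type} (G : ContextFreeGrammar T) {Sig : Type}
    (A : List (Symbol T G.NT) → Option (Option Sig)) : Language (Option Sig) :=
  { x | ∃ ws : List (List (Symbol T G.NT)),
      ws.head? = some [Symbol.nonterminal G.initial] ∧
      List.Chain' G.Produces ws ∧
      (∃ t : List T, ws.getLast? = some (t.map Symbol.terminal)) ∧
      x = (ws.map fun w => (A w).toList).flatten }

/-- The language `L_{⊥,f}(Ω) = L_f(Ω) ∩ Σ*`: the words of `L_f(Ω)` containing no `⊥`,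
viewed as a language over `Σ`. -/
def goLangBot {T : Type} (G : ContextFreeGrammar T) {Sig : Type}
    (A : List (Symbol T G.NT) → Option (Option Sig)) : Language Sig :=
  { x | (x.map some) ∈ goLang G A }

/-- Nonterminals `{S, A, B, C}` of the concrete grammar. -/
inductive NTg | S | A | B | C
deriving DecidableEq

/-- Terminals `{t, p}` of the concrete grammar. -/
inductive Tg | t | p
deriving DecidableEq

/-- Output letters `{a, b, c}` of the observer. -/
inductive Out3 | a | b | c
deriving DecidableEq

instance : DecidableEq (Symbol Tg NTg) := fun x y => by
  cases x <;> cases y <;> first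
    | (apply isFalse; intro h; cases h; done)
    | (rename_i u v; exact if h : u = v then isTrue (by rw [h]) else
        isFalse (fun hh => h (by injection hh)))

instance : DecidableEq (ContextFreeRule Tg NTg) := fun a b =>
  decidable_of_iff (a.input = b.input ∧ a.output = b.output) (by
    constructor
    · rintro ⟨h1, h2⟩; cases a; cases b; simp_all
    · rintro rfl; exact ⟨rfl, rfl⟩)

/-- The grammar `G` with productions
`S → pS, S → p, S → A, A → AB, A → C, B → C, C → t`. -/
def Gconcrete : ContextFreeGrammar Tg where
  NT := NTg
  initial := NTg.S
  rules :=
    { ⟨NTg.S, [Symbol.terminal Tg.p, Symbol.nonterminal NTg.S]⟩,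
      ⟨NTg.S, [Symbol.terminal Tg.p]⟩,
      ⟨NTg.S, [Symbol.nonterminal NTg.A]⟩,
      ⟨NTg.A, [Symbol.nonterminal NTg.A, Symbol.nonterminal NTg.B]⟩,
      ⟨NTg.A, [Symbol.nonterminal NTg.C]⟩,
      ⟨NTg.B, [Symbol.nonterminal NTg.C]⟩,
      ⟨NTg.C, [Symbol.terminal Tg.t]⟩ }

open scoped Classical in
/-- The observer `A''`:  `λ` on `S`;  `a` on `AB*`;  `b` on `C⁺B*`;  `c` on `t⁺C*`;
`⊥` (encoded as `some none`) otherwise. -/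
noncomputable def obsFive (w : List (Symbol Tg NTg)) : Option (Option Out3) :=
  if w = [Symbol.nonterminal NTg.S] then none
  else if ∃ n : ℕ,
      w = Symbol.nonterminal NTg.A :: List.replicate n (Symbol.nonterminal NTg.B) then
    some (some Out3.a)
  else if ∃ i j : ℕ, 1 ≤ i ∧
      w = List.replicate i (Symbol.nonterminal NTg.C)
        ++ List.replicate j (Symbol.nonterminal NTg.B) then
    some (some Out3.b)
  else if ∃ i j : ℕ, 1 ≤ i ∧
      w = List.replicate i (Symbol.terminal Tg.t)
        ++ List.replicate j (Symbol.nonterminal NTg.C) then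
    some (some Out3.c)
  else some none

/-- The language `{aⁿbⁿcⁿ : n > 0}`. -/
def Lfive : Language Out3 :=
  { x | ∃ n : ℕ, 0 < n ∧
      x = List.replicate n Out3.a ++ List.replicate n Out3.b ++ List.replicate n Out3.c }


section NonCF

inductive CFDer {T : Type} (g : ContextFreeGrammar T) : List (Symbol T g.NT) → List T → Prop
  | nil : CFDer g [] []
  | term (t : T) (s : List (Symbol T g.NT)) (w : List T) (h : CFDer g s w) :
      CFDer g (Symbol.terminal t :: s) (t :: w)
  | nonterm (r : ContextFreeRule T g.NT) (hr : r ∈ g.rules) (s : List (Symbol T g.NT))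
      (w₁ w₂ : List T) (h₁ : CFDer g r.output w₁) (h₂ : CFDer g s w₂) :
      CFDer g (Symbol.nonterminal r.input :: s) (w₁ ++ w₂)

variable {T : Type} {g : ContextFreeGrammar T}

lemma CFDer.of_map (w : List T) : CFDer g (w.map Symbol.terminal) w := by
  induction w with
  | nil => exact .nil
  | cons t w ih => exact .term t _ _ ih

lemma CFDer.split (s₁ : List (Symbol T g.NT)) : ∀ (s₂ : List (Symbol T g.NT)) (w : List T),
    CFDer g (s₁ ++ s₂) w → ∃ w₁ w₂, w = w₁ ++ w₂ ∧ CFDer g s₁ w₁ ∧ CFDer g s₂ w₂ := by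
  induction s₁ with
  | nil => intro s₂ w h; exact ⟨[], w, rfl, .nil, h⟩
  | cons x s₁ ih =>
    intro s₂ w h
    rw [List.cons_append] at h
    cases h with
    | term t _ w' h =>
      obtain ⟨w₁, w₂, rfl, h1, h2⟩ := ih _ _ h
      exact ⟨t :: w₁, w₂, rfl, .term _ _ _ h1, h2⟩
    | nonterm r hr _ u v hu hv =>
      obtain ⟨w₁, w₂, rfl, h1, h2⟩ := ih _ _ hv
      exact ⟨u ++ w₁, w₂, by simp, .nonterm r hr _ _ _ hu h1, h2⟩

lemma CFDer.of_rewrites {r : ContextFreeRule T g.NT} (hr : r ∈ g.rules)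
    {s s' : List (Symbol T g.NT)} (h : r.Rewrites s s') :
    ∀ w, CFDer g s' w → CFDer g s w := by
  induction h with
  | head s =>
    intro w hw
    obtain ⟨w₁, w₂, rfl, h1, h2⟩ := CFDer.split _ _ _ hw
    exact .nonterm r hr _ _ _ h1 h2
  | cons x _ ih =>
    intro w hw
    cases hw with
    | term t _ w' h => exact .term _ _ _ (ih _ h)
    | nonterm r hr _ u v hu hv => exact .nonterm r hr _ _ _ hu (ih _ hv)

lemma CFDer.of_derives {s : List (Symbol T g.NT)} {w : List T}
    (h : g.Derives s (w.map Symbol.terminal)) : CFDer g s w := by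
  induction h using Relation.ReflTransGen.head_induction_on with
  | refl => exact .of_map w
  | head h _ ih =>
    obtain ⟨r, hr, h⟩ := h
    exact CFDer.of_rewrites hr h _ ih

lemma CFDer.derives {s : List (Symbol T g.NT)} {w : List T} (h : CFDer g s w) :
    g.Derives s (w.map Symbol.terminal) := by
  induction h with
  | nil => exact Relation.ReflTransGen.refl
  | term t s w h ih => exact ih.append_left [Symbol.terminal t]
  | nonterm r hr s w₁ w₂ h₁ h₂ ih₁ ih₂ =>
    have h1 : g.Produces (Symbol.nonterminal r.input :: s) (r.output ++ s) :=
      ⟨r, hr, .head s⟩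
    rw [List.map_append]
    exact (h1.single.trans (ih₁.append_right s)).trans (ih₂.append_left _)

lemma CFDer.exists_sub (m k : ℕ) (hk : 1 ≤ k) (hm : ∀ r ∈ g.rules, r.output.length ≤ m)
    {s : List (Symbol T g.NT)} {w : List T} (h : CFDer g s w) :
    k * s.length < w.length → ∃ r ∈ g.rules, ∃ x w' y, w = x ++ w' ++ y ∧
      g.Derives s (x.map Symbol.terminal ++ [Symbol.nonterminal r.input] ++
        y.map Symbol.terminal) ∧
      g.Derives [Symbol.nonterminal r.input] (w'.map Symbol.terminal) ∧
      k < w'.length ∧ w'.length ≤ m * k := by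
  induction h with
  | nil => simp
  | term t s w h ih =>
    intro hl
    simp only [List.length_cons] at hl
    obtain ⟨r, hr, x, w', y, rfl, h1, h2, h3⟩ := ih (by nlinarith)
    exact ⟨r, hr, t :: x, w', y, rfl, h1.append_left [Symbol.terminal t], h2, h3⟩
  | nonterm r hr s w₁ w₂ h₁ h₂ ih₁ ih₂ =>
    intro hl
    simp only [List.length_cons, List.length_append] at hl
    have h0 : g.Produces [Symbol.nonterminal r.input] r.output :=
      ⟨r, hr, .input_output⟩
    by_cases c : k * s.length < w₂.length
    · obtain ⟨r', hr', x, w', y, rfl, h1, h2, h3⟩ := ih₂ c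
      refine ⟨r', hr', w₁ ++ x, w', y, by simp, ?_, h2, h3⟩
      have e1 := ((h0.single.trans h₁.derives).append_right s).trans
        (h1.append_left (w₁.map Symbol.terminal))
      simpa using e1
    · have hw1 : k < w₁.length := by nlinarith
      by_cases c' : w₁.length ≤ m * k
      · refine ⟨r, hr, [], w₁, w₂, by simp, ?_, h0.single.trans h₁.derives, hw1, c'⟩
        exact h₂.derives.append_left [Symbol.nonterminal r.input]
      · have := hm r hr
        obtain ⟨r', hr', x, w', y, rfl, h1, h2, h3⟩ := ih₁ (by nlinarith)
        refine ⟨r', hr', x, w', y ++ w₂, by simp, ?_, h2, h3⟩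
        have e1 := ((h0.single.trans h1).append_right s).trans
          (h₂.derives.append_left _)
        simpa using e1

lemma abc_miss (n : ℕ) (x w y : List Out3) (h : List.replicate n Out3.a ++
    List.replicate n Out3.b ++ List.replicate n Out3.c = x ++ w ++ y) (hw : w.length ≤ n) :
    w.count Out3.a = 0 ∨ w.count Out3.c = 0 := by
  by_contra! hc
  obtain ⟨h1, h2⟩ := hc
  rw [Ne, List.count_eq_zero, not_not, List.mem_iff_getElem] at h1 h2
  obtain ⟨p, hp, h1⟩ := h1
  obtain ⟨q, hq, h2⟩ := h2
  have e1 : (x ++ w ++ y)[x.length + p]? = some Out3.a := by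
    rw [List.append_assoc, List.getElem?_append_right (by omega), Nat.add_sub_cancel_left,
      List.getElem?_append_left hp, List.getElem?_eq_getElem hp, h1]
  have e2 : (x ++ w ++ y)[x.length + q]? = some Out3.c := by
    rw [List.append_assoc, List.getElem?_append_right (by omega), Nat.add_sub_cancel_left,
      List.getElem?_append_left hq, List.getElem?_eq_getElem hq, h2]
  rw [← h] at e1 e2
  simp only [List.append_assoc, List.getElem?_append, List.length_replicate,
    List.getElem?_replicate] at e1 e2
  split_ifs at e1 e2 <;> first | omega | simp_all

theorem Lfive_not_cf : ¬ Language.IsContextFree Lfive := by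
  rintro ⟨g, hg⟩
  obtain ⟨m, hm1, hm⟩ : ∃ m, 1 ≤ m ∧ ∀ r ∈ g.rules, r.output.length ≤ m := by
    refine ⟨g.rules.sup (fun r => r.output.length) + 1, by omega, fun r hr => ?_⟩
    have := Finset.le_sup (f := fun r : ContextFreeRule Out3 g.NT => r.output.length) hr
    omega
  set K := g.rules.card with hK
  set n := m ^ (K + 1) with hn
  have hnpos : 0 < n := by positivity
  set z := List.replicate n Out3.a ++ List.replicate n Out3.b ++ List.replicate n Out3.c with hz
  have hzL : z ∈ Lfive := ⟨n, hnpos, rfl⟩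
  rw [← hg, ContextFreeGrammar.mem_language_iff] at hzL
  have hd := CFDer.of_derives hzL
  have key : ∀ i : Fin (K + 1), ∃ r ∈ g.rules, ∃ x w' y, z = x ++ w' ++ y ∧
      g.Derives [Symbol.nonterminal g.initial] (x.map Symbol.terminal ++
        [Symbol.nonterminal r.input] ++ y.map Symbol.terminal) ∧
      g.Derives [Symbol.nonterminal r.input] (w'.map Symbol.terminal) ∧
      m ^ (i : ℕ) < w'.length ∧ w'.length ≤ m * m ^ (i : ℕ) := by
    intro i
    refine hd.exists_sub m (m ^ (i : ℕ)) (Nat.one_le_pow _ _ hm1) hm ?_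
    have : m ^ (i : ℕ) ≤ n := Nat.pow_le_pow_right hm1 (by omega)
    simp [hz]
    omega
  choose r hr x w y h1 h2 h3 h4 h5 using key
  obtain ⟨i, -, j, -, hij, e⟩ := Finset.exists_ne_map_eq_of_card_lt_of_maps_to
    (s := (Finset.univ : Finset (Fin (K + 1)))) (t := g.rules) (by simp [hK])
    (f := r) (fun i _ => hr i)
  have hle : ∀ i, (w i).length ≤ n := by
    intro i
    refine (h5 i).trans ?_
    rw [← pow_succ']
    exact Nat.pow_le_pow_right hm1 (by omega)
  have hlt : ∀ i j : Fin (K + 1), i < j → (w i).length < (w j).length := by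
    intro i j hij
    refine (h5 i).trans_lt (lt_of_le_of_lt ?_ (h4 j))
    rw [← pow_succ']
    exact Nat.pow_le_pow_right hm1 (by omega)
  have hne : (w i).length ≠ (w j).length := by
    rcases lt_or_gt_of_ne hij with h | h
    · exact (hlt _ _ h).ne
    · exact (hlt _ _ h).ne'
  have hmem : x i ++ w j ++ y i ∈ g.language := by
    rw [ContextFreeGrammar.mem_language_iff]
    have := (h2 i).trans (((e ▸ h3 j).append_left _).append_right _)
    simpa using this
  rw [hg] at hmem
  obtain ⟨l, -, hl⟩ := hmem
  have m1 := abc_miss n _ _ _ (h1 i) (hle i)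
  have m2 := abc_miss n _ _ _ (h1 j) (hle j)
  have cnt : ∀ v : List Out3, v.length = v.count Out3.a + v.count Out3.b + v.count Out3.c := by
    intro v
    induction v with
    | nil => rfl
    | cons o v ih => cases o <;> simp [ih] <;> omega
  have hi := h1 i
  have ca := fun o => congrArg (List.count o) hi
  have cb := fun o => congrArg (List.count o) hl
  have a1 := ca Out3.a
  have a2 := ca Out3.b
  have a3 := ca Out3.c
  have b1 := cb Out3.a
  have b2 := cb Out3.b
  have b3 := cb Out3.c
  simp [hz, List.count_replicate] at a1 a2 a3 b1 b2 b3
  have := cnt (w i)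
  have := cnt (w j)
  omega

end NonCF

section Gen

local notation "sS" => (Symbol.nonterminal NTg.S : Symbol Tg NTg)
local notation "sA" => (Symbol.nonterminal NTg.A : Symbol Tg NTg)
local notation "sB" => (Symbol.nonterminal NTg.B : Symbol Tg NTg)
local notation "sC" => (Symbol.nonterminal NTg.C : Symbol Tg NTg)
local notation "sT" => (Symbol.terminal Tg.t : Symbol Tg NTg)
local notation "sP" => (Symbol.terminal Tg.p : Symbol Tg NTg)

def SStep (u v : List (Symbol Tg NTg)) : Prop := Gconcrete.Produces u v

lemma obs_form (w : List (Symbol Tg NTg)) : obsFive w = some none ∨ w = [sS] ∨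
    (∃ n, w = sA :: List.replicate n sB) ∨
    (∃ i j, w = List.replicate (i + 1) sC ++ List.replicate j sB) ∨
    (∃ i j, w = List.replicate (i + 1) sT ++ List.replicate j sC) := by
  unfold obsFive
  split_ifs with h1 h2 h3 h4
  · exact Or.inr (Or.inl h1)
  · exact Or.inr (Or.inr (Or.inl h2))
  · obtain ⟨i, j, hi, h⟩ := h3
    obtain ⟨i, rfl⟩ := Nat.exists_eq_add_of_le' hi
    exact Or.inr (Or.inr (Or.inr (Or.inl ⟨i, j, h⟩)))
  · obtain ⟨i, j, hi, h⟩ := h4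
    obtain ⟨i, rfl⟩ := Nat.exists_eq_add_of_le' hi
    exact Or.inr (Or.inr (Or.inr (Or.inr ⟨i, j, h⟩)))
  · exact Or.inl rfl

lemma obs_S : obsFive [sS] = none := by simp [obsFive]

lemma obs_A (n : ℕ) : obsFive (sA :: List.replicate n sB) = some (some Out3.a) := by
  simp [obsFive]

lemma obs_C (i j : ℕ) : obsFive (List.replicate (i + 1) sC ++ List.replicate j sB)
    = some (some Out3.b) := by
  unfold obsFive
  rw [if_neg, if_neg, if_pos ⟨i + 1, j, by omega, rfl⟩]
  · simp [List.replicate_succ]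
  · simp [List.replicate_succ]

lemma obs_T (i j : ℕ) : obsFive (List.replicate (i + 1) sT ++ List.replicate j sC)
    = some (some Out3.c) := by
  unfold obsFive
  rw [if_neg, if_neg, if_neg, if_pos ⟨i + 1, j, by omega, rfl⟩]
  · rintro ⟨i', j', hi, h⟩
    obtain ⟨i', rfl⟩ := Nat.exists_eq_add_of_le' hi
    simp [List.replicate_succ] at h
  · simp [List.replicate_succ]
  · simp [List.replicate_succ]

lemma sprod_iff (u v : List (Symbol Tg NTg)) : SStep u v ↔ ∃ p q,
    (u = p ++ [sS] ++ q ∧ v = p ++ [sP, sS] ++ q) ∨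
    (u = p ++ [sS] ++ q ∧ v = p ++ [sP] ++ q) ∨
    (u = p ++ [sS] ++ q ∧ v = p ++ [sA] ++ q) ∨
    (u = p ++ [sA] ++ q ∧ v = p ++ [sA, sB] ++ q) ∨
    (u = p ++ [sA] ++ q ∧ v = p ++ [sC] ++ q) ∨
    (u = p ++ [sB] ++ q ∧ v = p ++ [sC] ++ q) ∨
    (u = p ++ [sC] ++ q ∧ v = p ++ [sT] ++ q) := by
  have h : SStep u v ↔ ∃ r ∈ ({ ⟨NTg.S, [Symbol.terminal Tg.p, Symbol.nonterminal NTg.S]⟩,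
      ⟨NTg.S, [Symbol.terminal Tg.p]⟩,
      ⟨NTg.S, [Symbol.nonterminal NTg.A]⟩,
      ⟨NTg.A, [Symbol.nonterminal NTg.A, Symbol.nonterminal NTg.B]⟩,
      ⟨NTg.A, [Symbol.nonterminal NTg.C]⟩,
      ⟨NTg.B, [Symbol.nonterminal NTg.C]⟩,
      ⟨NTg.C, [Symbol.terminal Tg.t]⟩ } : Finset (ContextFreeRule Tg NTg)), r.Rewrites u v :=
    Iff.rfl
  rw [h]
  simp only [Finset.mem_insert, Finset.mem_singleton, exists_eq_or_imp, exists_eq_left,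
    ContextFreeRule.rewrites_iff, exists_or]

lemma step_S (w : List (Symbol Tg NTg)) (h : SStep [sS] w) (ho : obsFive w ≠ some none) :
    w = sA :: List.replicate 0 sB := by
  rw [sprod_iff] at h
  obtain ⟨p, q, h⟩ := h
  rcases (obs_form w).resolve_left ho with f | ⟨n, f⟩ | ⟨i, j, f⟩ | ⟨i, j, f⟩ <;>
  subst f <;>
  rcases h with ⟨h, h'⟩ | ⟨h, h'⟩ | ⟨h, h'⟩ | ⟨h, h'⟩ | ⟨h, h'⟩ | ⟨h, h'⟩ | ⟨h, h'⟩ <;>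
  · have c := fun s => congrArg (List.count s) h
    have c' := fun s => congrArg (List.count s) h'
    have c1 := c sS; have c2 := c sA; have c3 := c sB
    have c4 := c sC; have c5 := c sT; have c6 := c sP
    have d1 := c' sS; have d2 := c' sA; have d3 := c' sB
    have d4 := c' sC; have d5 := c' sT; have d6 := c' sP
    clear c c' h h' ho
    simp [List.count_replicate, List.count_append] at c1 c2 c3 c4 c5 c6 d1 d2 d3 d4 d5 d6
    all_goals first
    | (exfalso; omega)
    | (have : n = 0 := by omega
       subst this
       rfl)

lemma step_A (m : ℕ) (w : List (Symbol Tg NTg)) (h : SStep (sA :: List.replicate m sB) w)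
    (ho : obsFive w ≠ some none) :
    w = sA :: List.replicate (m + 1) sB ∨
    w = List.replicate (0 + 1) sC ++ List.replicate m sB := by
  rw [sprod_iff] at h
  obtain ⟨p, q, h⟩ := h
  rcases (obs_form w).resolve_left ho with f | ⟨n, f⟩ | ⟨i, j, f⟩ | ⟨i, j, f⟩ <;>
  subst f <;>
  rcases h with ⟨h, h'⟩ | ⟨h, h'⟩ | ⟨h, h'⟩ | ⟨h, h'⟩ | ⟨h, h'⟩ | ⟨h, h'⟩ | ⟨h, h'⟩ <;>
  · have c := fun s => congrArg (List.count s) h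
    have c' := fun s => congrArg (List.count s) h'
    have c1 := c sS; have c2 := c sA; have c3 := c sB
    have c4 := c sC; have c5 := c sT; have c6 := c sP
    have d1 := c' sS; have d2 := c' sA; have d3 := c' sB
    have d4 := c' sC; have d5 := c' sT; have d6 := c' sP
    clear c c' h h' ho
    simp [List.count_replicate, List.count_append] at c1 c2 c3 c4 c5 c6 d1 d2 d3 d4 d5 d6
    all_goals first
    | (exfalso; omega)
    | (have : n = m + 1 := by omega
       subst this
       exact Or.inl rfl)
    | (have h1 : i = 0 := by omega
       have h2 : j = m := by omega
       subst h1 h2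
       exact Or.inr rfl)

lemma step_C (a b : ℕ) (w : List (Symbol Tg NTg))
    (h : SStep (List.replicate (a + 1) sC ++ List.replicate b sB) w)
    (ho : obsFive w ≠ some none) :
    (∃ b', b = b' + 1 ∧ w = List.replicate (a + 1 + 1) sC ++ List.replicate b' sB) ∨
    (b = 0 ∧ w = List.replicate (0 + 1) sT ++ List.replicate a sC) := by
  rw [sprod_iff] at h
  obtain ⟨p, q, h⟩ := h
  rcases (obs_form w).resolve_left ho with f | ⟨n, f⟩ | ⟨i, j, f⟩ | ⟨i, j, f⟩ <;>
  subst f <;>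
  rcases h with ⟨h, h'⟩ | ⟨h, h'⟩ | ⟨h, h'⟩ | ⟨h, h'⟩ | ⟨h, h'⟩ | ⟨h, h'⟩ | ⟨h, h'⟩ <;>
  · have c := fun s => congrArg (List.count s) h
    have c' := fun s => congrArg (List.count s) h'
    have c1 := c sS; have c2 := c sA; have c3 := c sB
    have c4 := c sC; have c5 := c sT; have c6 := c sP
    have d1 := c' sS; have d2 := c' sA; have d3 := c' sB
    have d4 := c' sC; have d5 := c' sT; have d6 := c' sP
    clear c c' h h' ho
    simp [List.count_replicate, List.count_append] at c1 c2 c3 c4 c5 c6 d1 d2 d3 d4 d5 d6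
    all_goals first
    | (exfalso; omega)
    | (have h1 : i = a + 1 := by omega
       have h2 : b = j + 1 := by omega
       subst h1 h2
       exact Or.inl ⟨j, rfl, rfl⟩)
    | (have h1 : i = 0 := by omega
       have h2 : j = a := by omega
       have h3 : b = 0 := by omega
       subst h1 h2 h3
       exact Or.inr ⟨rfl, rfl⟩)

lemma step_T (a b : ℕ) (w : List (Symbol Tg NTg))
    (h : SStep (List.replicate (a + 1) sT ++ List.replicate b sC) w)
    (ho : obsFive w ≠ some none) :
    ∃ b', b = b' + 1 ∧ w = List.replicate (a + 1 + 1) sT ++ List.replicate b' sC := by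
  rw [sprod_iff] at h
  obtain ⟨p, q, h⟩ := h
  rcases (obs_form w).resolve_left ho with f | ⟨n, f⟩ | ⟨i, j, f⟩ | ⟨i, j, f⟩ <;>
  subst f <;>
  rcases h with ⟨h, h'⟩ | ⟨h, h'⟩ | ⟨h, h'⟩ | ⟨h, h'⟩ | ⟨h, h'⟩ | ⟨h, h'⟩ | ⟨h, h'⟩ <;>
  · have c := fun s => congrArg (List.count s) h
    have c' := fun s => congrArg (List.count s) h'
    have c1 := c sS; have c2 := c sA; have c3 := c sB
    have c4 := c sC; have c5 := c sT; have c6 := c sP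
    have d1 := c' sS; have d2 := c' sA; have d3 := c' sB
    have d4 := c' sC; have d5 := c' sT; have d6 := c' sP
    clear c c' h h' ho
    simp [List.count_replicate, List.count_append] at c1 c2 c3 c4 c5 c6 d1 d2 d3 d4 d5 d6
    all_goals first
    | (exfalso; omega)
    | (have h1 : i = a + 1 := by omega
       have h2 : b = j + 1 := by omega
       subst h1 h2
       exact ⟨j, rfl, rfl⟩)

inductive SRun : List (Symbol Tg NTg) → List (Option Out3) → Prop
  | last (t : List Tg) : SRun (t.map Symbol.terminal) (obsFive (t.map Symbol.terminal)).toList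
  | step (w w' : List (Symbol Tg NTg)) (x : List (Option Out3)) (h : SStep w w')
      (hr : SRun w' x) : SRun w ((obsFive w).toList ++ x)

lemma srun_of_chain (ws : List (List (Symbol Tg NTg))) : ∀ w, List.IsChain SStep (w :: ws) →
    (∃ t : List Tg, (w :: ws).getLast? = some (t.map Symbol.terminal)) →
    SRun w (((w :: ws).map fun w => (obsFive w).toList).flatten) := by
  induction ws with
  | nil =>
    rintro w - ⟨t, ht⟩
    simp only [List.getLast?_singleton, Option.some.injEq] at ht
    subst ht
    simpa using SRun.last t
  | cons v ws ih =>
    intro w hc ⟨t, ht⟩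
    rw [List.isChain_cons_cons] at hc
    rw [List.getLast?_cons_cons] at ht
    rw [List.map_cons, List.flatten_cons]
    exact .step _ _ _ hc.1 (ih v hc.2 ⟨t, ht⟩)

lemma chain_of_srun {w : List (Symbol Tg NTg)} {x : List (Option Out3)} (h : SRun w x) :
    ∃ ws, List.IsChain SStep (w :: ws) ∧
    (∃ t : List Tg, (w :: ws).getLast? = some (t.map Symbol.terminal)) ∧
    x = (((w :: ws).map fun w => (obsFive w).toList).flatten) := by
  induction h with
  | last t => exact ⟨[], by simp, ⟨t, rfl⟩, by simp⟩
  | step w w' x h hr ih =>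
    obtain ⟨ws, h1, ⟨t, h2⟩, h3⟩ := ih
    refine ⟨w' :: ws, List.isChain_cons_cons.2 ⟨h, h1⟩, ⟨t, ?_⟩, ?_⟩
    · rw [List.getLast?_cons_cons, h2]
    · rw [List.map_cons, List.flatten_cons, h3]

lemma mem_goLang_iff (x : List (Option Out3)) :
    x ∈ goLang Gconcrete obsFive ↔ SRun [sS] x := by
  constructor
  · rintro ⟨ws, h1, h2, h3, rfl⟩
    cases ws with
    | nil => simp at h1
    | cons w ws =>
      simp only [List.head?_cons, Option.some.injEq] at h1
      subst h1
      exact srun_of_chain ws _ h2 h3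
  · intro h
    obtain ⟨ws, h1, h2, h3⟩ := chain_of_srun h
    exact ⟨_ :: ws, rfl, h1, h2, h3⟩

lemma SRun.obs {w : List (Symbol Tg NTg)} {x : List (Option Out3)} (h : SRun w x)
    (hx : none ∉ x) : obsFive w ≠ some none := by
  intro ho
  cases h <;> simp [ho] at hx

def FormRes (w : List (Symbol Tg NTg)) (x : List (Option Out3)) : Prop :=
  (w = [sS] → ∃ k, x = List.replicate (k + 1) (some Out3.a) ++
    List.replicate (k + 1) (some Out3.b) ++ List.replicate (k + 1) (some Out3.c)) ∧
  (∀ m, w = sA :: List.replicate m sB → ∃ k, x = List.replicate (k + 1) (some Out3.a) ++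
    List.replicate (m + k + 1) (some Out3.b) ++ List.replicate (m + k + 1) (some Out3.c)) ∧
  (∀ i j, w = List.replicate (i + 1) sC ++ List.replicate j sB →
    x = List.replicate (j + 1) (some Out3.b) ++ List.replicate (i + j + 1) (some Out3.c)) ∧
  (∀ i j, w = List.replicate (i + 1) sT ++ List.replicate j sC →
    x = List.replicate (j + 1) (some Out3.c))

lemma srun_res {w : List (Symbol Tg NTg)} {x : List (Option Out3)} (h : SRun w x) :
    none ∉ x → FormRes w x := by
  induction h with
  | last t =>
    intro _
    refine ⟨fun h => ?_, fun m h => ?_, fun i j h => ?_, fun i j h => ?_⟩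
    · have := congrArg (sS ∈ ·) h
      simp at this
    · have := congrArg (sA ∈ ·) h
      simp at this
    · have := congrArg (sC ∈ ·) h
      simp at this
    · have := congrArg (sC ∈ ·) h
      simp at this
      subst this
      rw [h, obs_T]
      rfl
  | step w w' x hp hr ih =>
    intro hx
    rw [List.mem_append, not_or] at hx
    have ho := hr.obs hx.2
    obtain ⟨i1, i2, i3, i4⟩ := ih hx.2
    refine ⟨fun h => ?_, fun m h => ?_, fun i j h => ?_, fun i j h => ?_⟩ <;> subst h
    · obtain ⟨k, hk⟩ := i2 _ (step_S _ hp ho)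
      refine ⟨k, ?_⟩
      rw [obs_S, hk]
      simp
    · rcases step_A _ _ hp ho with h | h
      · obtain ⟨k, hk⟩ := i2 _ h
        refine ⟨k + 1, ?_⟩
        rw [obs_A, hk, show m + 1 + k + 1 = m + (k + 1) + 1 by omega,
          List.replicate_succ (n := k + 1)]
        simp
      · refine ⟨0, ?_⟩
        rw [obs_A, i3 _ _ h]
        simp
    · rcases step_C _ _ _ hp ho with ⟨b, rfl, h⟩ | ⟨rfl, h⟩
      · rw [obs_C, i3 _ _ h, show i + 1 + b + 1 = i + (b + 1) + 1 by omega,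
          List.replicate_succ (n := b + 1)]
        simp
      · rw [obs_C, i4 _ _ h]
        simp
    · obtain ⟨b, rfl, h⟩ := step_T _ _ _ hp ho
      rw [obs_T, i4 _ _ h, List.replicate_succ (n := b + 1)]
      simp

lemma run_T (j : ℕ) : ∀ i, SRun (List.replicate (i + 1) sT ++ List.replicate j sC)
    (List.replicate (j + 1) (some Out3.c)) := by
  induction j with
  | zero =>
    intro i
    have := SRun.last (List.replicate (i + 1) Tg.t)
    have e := obs_T i 0
    simp only [List.map_replicate, List.replicate_zero, List.append_nil] at this e ⊢
    rw [e] at this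
    simpa using this
  | succ j ih =>
    intro i
    have := SRun.step (List.replicate (i + 1) sT ++ List.replicate (j + 1) sC) _ _
      ((sprod_iff _ _).2 ⟨List.replicate (i + 1) sT, List.replicate j sC, by
        simp only [List.replicate_succ' (n := i + 1)]
        simp [List.replicate_succ (n := j)]⟩) (ih (i + 1))
    rw [obs_T] at this
    rw [List.replicate_succ (n := j + 1)]
    simpa using this

lemma run_C (j : ℕ) : ∀ i, SRun (List.replicate (i + 1) sC ++ List.replicate j sB)
    (List.replicate (j + 1) (some Out3.b) ++ List.replicate (i + j + 1) (some Out3.c)) := by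
  induction j with
  | zero =>
    intro i
    have := SRun.step (List.replicate (i + 1) sC ++ List.replicate 0 sB) _ _
      ((sprod_iff _ _).2 ⟨[], List.replicate i sC, by simp [List.replicate_succ (n := i)]⟩)
      (run_T i 0)
    rw [obs_C] at this
    simpa using this
  | succ j ih =>
    intro i
    have := SRun.step (List.replicate (i + 1) sC ++ List.replicate (j + 1) sB) _ _
      ((sprod_iff _ _).2 ⟨List.replicate (i + 1) sC, List.replicate j sB, by
        simp only [List.replicate_succ' (n := i + 1)]
        simp [List.replicate_succ (n := j)]⟩) (ih (i + 1))
    rw [obs_C] at this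
    rw [List.replicate_succ (n := j + 1), show i + (j + 1) + 1 = i + 1 + j + 1 by omega]
    simpa using this

lemma run_A (k : ℕ) : ∀ m, SRun (sA :: List.replicate m sB)
    (List.replicate (k + 1) (some Out3.a) ++
    List.replicate (m + k + 1) (some Out3.b) ++ List.replicate (m + k + 1) (some Out3.c)) := by
  induction k with
  | zero =>
    intro m
    have := SRun.step (sA :: List.replicate m sB) _ _
      ((sprod_iff _ _).2 ⟨[], List.replicate m sB, by simp⟩) (run_C m 0)
    rw [obs_A] at this
    simpa using this
  | succ k ih =>
    intro m
    have := SRun.step (sA :: List.replicate m sB) _ _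
      ((sprod_iff _ _).2 ⟨[], List.replicate m sB, by simp [List.replicate_succ (n := m)]⟩)
      (ih (m + 1))
    rw [obs_A] at this
    rw [List.replicate_succ (n := k + 1), show m + (k + 1) + 1 = m + 1 + k + 1 by omega]
    simpa using this

lemma run_S (k : ℕ) : SRun [sS] (List.replicate (k + 1) (some Out3.a) ++
    List.replicate (k + 1) (some Out3.b) ++ List.replicate (k + 1) (some Out3.c)) := by
  have := SRun.step [sS] _ _ ((sprod_iff _ _).2 ⟨[], [], by simp⟩) (run_A k 0)
  rw [obs_S] at this
  simpa using this

theorem goLangBot_eq : goLangBot Gconcrete obsFive = Lfive := by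
  ext x
  change List.map some x ∈ goLang Gconcrete obsFive ↔ _
  rw [mem_goLang_iff]
  constructor
  · intro h
    obtain ⟨k, hk⟩ := (srun_res h (by simp)).1 rfl
    refine ⟨k + 1, by omega, ?_⟩
    apply List.map_injective_iff.2 (Option.some_injective _)
    simpa using hk
  · rintro ⟨n, hn, rfl⟩
    obtain ⟨k, rfl⟩ := Nat.exists_eq_add_of_le' hn
    simpa using run_S k

end Gen

section Reg

inductive QS | st | s1 | qA | qC | qCB | qT | qTC | dead
deriving DecidableEq

instance : Fintype QS where
  elems := {QS.st, QS.s1, QS.qA, QS.qC, QS.qCB, QS.qT, QS.qTC, QS.dead}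
  complete x := by cases x <;> simp

def qstep : QS → Symbol Tg NTg → QS
  | .st, .nonterminal .S => .s1
  | .st, .nonterminal .A => .qA
  | .st, .nonterminal .C => .qC
  | .st, .terminal .t => .qT
  | .qA, .nonterminal .B => .qA
  | .qC, .nonterminal .C => .qC
  | .qC, .nonterminal .B => .qCB
  | .qCB, .nonterminal .B => .qCB
  | .qT, .terminal .t => .qT
  | .qT, .nonterminal .C => .qTC
  | .qTC, .nonterminal .C => .qTC
  | _, _ => .dead

def qout : QS → Option (Option Out3)
  | .s1 => none
  | .qA => some (some .a)
  | .qC => some (some .b)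
  | .qCB => some (some .b)
  | .qT => some (some .c)
  | .qTC => some (some .c)
  | _ => some none

def qform (w : List (Symbol Tg NTg)) : QS → Prop
  | .st => w = []
  | .s1 => w = [.nonterminal .S]
  | .qA => ∃ n, w = .nonterminal .A :: List.replicate n (.nonterminal .B)
  | .qC => ∃ i, w = List.replicate (i + 1) (.nonterminal .C)
  | .qCB => ∃ i j, w = List.replicate (i + 1) (.nonterminal .C) ++
      List.replicate j (.nonterminal .B)
  | .qT => ∃ i, w = List.replicate (i + 1) (.terminal .t)
  | .qTC => ∃ i j, w = List.replicate (i + 1) (.terminal .t) ++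
      List.replicate j (.nonterminal .C)
  | .dead => True

lemma qform_eval (w : List (Symbol Tg NTg)) : qform w (w.foldl qstep .st) := by
  induction w using List.reverseRecOn with
  | nil => rfl
  | append_singleton w x ih =>
    rw [List.foldl_append, List.foldl_cons, List.foldl_nil]
    generalize w.foldl qstep .st = q at ih ⊢
    rcases x with (_ | _) | (_ | _ | _ | _) <;> cases q <;>
      first
      | exact trivial
      | (have h : w = [] := ih; subst h; first | rfl | exact ⟨0, rfl⟩)
      | (obtain ⟨n, rfl⟩ := ih
         first
         | (refine ⟨n, 1, ?_⟩; rfl)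
         | (refine ⟨n + 1, ?_⟩; simp [List.replicate_succ']; done))
      | (obtain ⟨n, m, rfl⟩ := ih
         exact ⟨n, m + 1, by simp [List.replicate_succ']⟩)

lemma foldl_rep (q q' : QS) (x : Symbol Tg NTg) (h : qstep q x = q') (h' : qstep q' x = q')
    (n : ℕ) : (List.replicate n x).foldl qstep q = if n = 0 then q else q' := by
  have key : ∀ n, (List.replicate n x).foldl qstep q' = q' := by
    intro n
    induction n with
    | zero => rfl
    | succ n ih => rw [List.replicate_succ, List.foldl_cons, h', ih]
  cases n with
  | zero => rfl
  | succ n => rw [List.replicate_succ, List.foldl_cons, h, key]; simp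

lemma obs_eq_qout (w : List (Symbol Tg NTg)) : obsFive w = qout (w.foldl qstep .st) := by
  rcases obs_form w with h | rfl | ⟨n, rfl⟩ | ⟨i, j, rfl⟩ | ⟨i, j, rfl⟩
  · have hf := qform_eval w
    rw [h]
    generalize w.foldl qstep .st = q at hf ⊢
    cases q with
    | st => rfl
    | dead => rfl
    | s1 => rw [show w = _ from hf, obs_S] at h; simp at h
    | qA => obtain ⟨n, rfl⟩ := hf; rw [obs_A] at h; simp at h
    | qC => obtain ⟨n, rfl⟩ := hf; have := obs_C n 0; simp [h] at this
    | qCB => obtain ⟨n, m, rfl⟩ := hf; rw [obs_C] at h; simp at h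
    | qT => obtain ⟨n, rfl⟩ := hf; have := obs_T n 0; simp [h] at this
    | qTC => obtain ⟨n, m, rfl⟩ := hf; rw [obs_T] at h; simp at h
  · rw [obs_S]; rfl
  · rw [obs_A, List.foldl_cons, foldl_rep _ QS.qA _ rfl rfl]
    split_ifs <;> rfl
  · rw [obs_C, List.foldl_append, foldl_rep QS.st QS.qC _ rfl rfl, if_neg (by omega),
      foldl_rep _ QS.qCB _ rfl rfl]
    split_ifs <;> rfl
  · rw [obs_T, List.foldl_append, foldl_rep QS.st QS.qT _ rfl rfl, if_neg (by omega),
      foldl_rep _ QS.qTC _ rfl rfl]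
    split_ifs <;> rfl

theorem obs_regular : ObserverRegular obsFive := by
  intro o
  refine ⟨QS, inferInstance, ⟨qstep, .st, {q | qout q = o}⟩, ?_⟩
  ext w
  change qout (w.foldl qstep .st) = o ↔ obsFive w = o
  rw [obs_eq_qout]

end Reg
/-- The observer `A''` is a monadic transducer, the G/O system
`Ω = (G, A'')` satisfies `L_{⊥,f}(Ω) = {aⁿbⁿcⁿ : n > 0}`, and this language is not
context-free (it is context-sensitive). -/
theorem goLangBot_concrete_eq_anbncn :
    ObserverRegular obsFive ∧
    goLangBot Gconcrete obsFive = Lfive ∧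
    ¬ Language.IsContextFree Lfive := by
  exact ⟨obs_regular, goLangBot_eq, Lfive_not_cf⟩
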